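/- arXiv:1210.6270 — 2 statements merged into one kernel-verified Lean document; each statement's English description precedes it below -/
import Mathlib

section
/- There exists C > 0 such that Ψ(ξ) ≤ C for every ξ = (ξ₁,…,ξ_N) ∈ ℳ satisfying (ξ_j − p_r)/|ξ_j − p_r| = e^{i(θ_{p_r} + jδ/N)} for all j ∈ I_r and r = 1,…,m. -/
open Real Set Metric Filter MeasureTheory

/-- The Laplacian of a real-valued function on the plane ℝ² ≅ ℂ. -/
noncomputable def planeLap (f : ℂ → ℝ) (x : ℂ) : ℝ :=
  fderiv ℝ (fun y => fderiv ℝ f y 1) x 1 +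
  fderiv ℝ (fun y => fderiv ℝ f y Complex.I) x Complex.I

/-- A function is harmonic on a set if it is C² there with vanishing Laplacian. -/
def HarmonicOnSet (f : ℂ → ℝ) (s : Set ℂ) : Prop :=
  ContDiffOn ℝ 2 f s ∧ ∀ x ∈ s, planeLap f x = 0

/-- `RegPart Ω H`: H is the regular part of the Dirichlet Green's function of −Δ on Ω:
for each x ∈ Ω, y ↦ H(x,y) is harmonic on Ω, extends continuously to the closure of Ω,
with boundary values (1/(2π))·log|x−y| on ∂Ω; moreover H is symmetric on Ω × Ω. -/
def RegPart (Ω : Set ℂ) (H : ℂ → ℂ → ℝ) : Prop :=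
  (∀ x ∈ Ω, HarmonicOnSet (fun y => H x y) Ω ∧
      ContinuousOn (fun y => H x y) (closure Ω) ∧
      ∀ y ∈ frontier Ω, H x y = (1 / (2 * π)) * Real.log ‖x - y‖) ∧
  (∀ x ∈ Ω, ∀ y ∈ Ω, H x y = H y x)

/-- The Green's function G(x,y) = (1/(2π))·log(1/|x−y|) + H(x,y). -/
noncomputable def green (H : ℂ → ℂ → ℝ) (x y : ℂ) : ℝ :=
  (1 / (2 * π)) * Real.log (1 / ‖x - y‖) + H x y

/-- The function Ψ(ξ) = (1/2)ΣH(ξ_j,ξ_j) − Σ_p (α_p/2)Σ_j G(ξ_j,p) + (1/2)Σ_{j≠k}G(ξ_j,ξ_k). -/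
noncomputable def PsiFun (H : ℂ → ℂ → ℝ) (Z : Finset ℂ) (α : ℂ → ℝ) {N : ℕ}
    (ξ : Fin N → ℂ) : ℝ :=
  (1 / 2) * ∑ j, H (ξ j) (ξ j) - ∑ p ∈ Z, (α p / 2) * ∑ j, green H (ξ j) p +
    (1 / 2) * ∑ j, ∑ k, if j ≠ k then green H (ξ j) (ξ k) else 0

/-- The function Φ(ξ) = (1/2)ΣH(ξ_j,ξ_j) − Σ_p (α_p/2)Σ_j G(ξ_j,p) − (1/2)Σ_{j≠k}G(ξ_j,ξ_k). -/
noncomputable def PhiFun (H : ℂ → ℂ → ℝ) (Z : Finset ℂ) (α : ℂ → ℝ) {N : ℕ}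
    (ξ : Fin N → ℂ) : ℝ :=
  (1 / 2) * ∑ j, H (ξ j) (ξ j) - ∑ p ∈ Z, (α p / 2) * ∑ j, green H (ξ j) p -
    (1 / 2) * ∑ j, ∑ k, if j ≠ k then green H (ξ j) (ξ k) else 0

/-- Membership in the configuration space ℳ = {ξ ∈ (Ω∖Z)^N : ξ_j ≠ ξ_k for j ≠ k}. -/
def memM (Ω : Set ℂ) (Z : Finset ℂ) {N : ℕ} (ξ : Fin N → ℂ) : Prop :=
  (∀ j, ξ j ∈ Ω ∧ ξ j ∉ Z) ∧ Function.Injective ξ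

/-- The cone {p + ρe^{i(θ_p+t)} : ρ ≥ 0, |t| ≤ δ} with vertex p. -/
def coneAt (θ : ℂ → ℝ) (δ : ℝ) (p : ℂ) : Set ℂ :=
  {z | ∃ ρ : ℝ, 0 ≤ ρ ∧ ∃ t : ℝ, |t| ≤ δ ∧
    z = p + (ρ : ℂ) * Complex.exp (((θ p + t : ℝ) : ℂ) * Complex.I)}

/-- Start index of the r-th consecutive block I_r of {0,…,N−1}. -/
def blkLo {m : ℕ} (Nr : Fin m → ℕ) (r : Fin m) : ℕ :=
  ∑ s ∈ Finset.univ.filter (fun s => s < r), Nr s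

/-- `inBlk Nr r j`: the index j belongs to the r-th consecutive block I_r. -/
def inBlk {m : ℕ} (Nr : Fin m → ℕ) (r : Fin m) {N : ℕ} (j : Fin N) : Prop :=
  blkLo Nr r ≤ (j : ℕ) ∧ (j : ℕ) < blkLo Nr r + Nr r

/-- `onRays θ δ P Nr ξ`: for every r and every j ∈ I_r the point ξ_j lies on the ray
emanating from p_r with angle θ_{p_r} + jδ/N, i.e. (ξ_j − p_r)/|ξ_j − p_r| = e^{i(θ_{p_r}+jδ/N)}. -/
def onRays (θ : ℂ → ℝ) (δ : ℝ) {m : ℕ} (P : Fin m → ℂ) (Nr : Fin m → ℕ) {N : ℕ}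
    (ξ : Fin N → ℂ) : Prop :=
  ∀ r : Fin m, ∀ j : Fin N, inBlk Nr r j →
    ξ j - P r = (‖ξ j - P r‖ : ℂ) *
      Complex.exp (((θ (P r) + ((j : ℕ) + 1) * δ / (N : ℝ) : ℝ) : ℂ) * Complex.I)

theorem fderiv_fderiv_le_of_isLocalMax {f : ℂ → ℝ} {z v : ℂ} {a b : ℝ}
    (hf : ContDiffAt ℝ 2 f z)
    (hmax : IsLocalMax (fun t : ℝ => f (z + (t : ℂ) * v) + (a * t + b * t ^ 2)) 0) :
    fderiv ℝ (fun y => fderiv ℝ f y v) z v + 2 * b ≤ 0 := by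
  set φ : ℝ → ℝ := fun t => f (z + (t : ℂ) * v) + (a * t + b * t ^ 2) with hφ
  have hline (t : ℝ) : HasDerivAt (fun t : ℝ => z + (t : ℂ) * v) v t := by
    simpa using ((Complex.ofRealCLM.hasDerivAt (x := t)).mul_const v).const_add z
  have hline0 : Tendsto (fun t : ℝ => z + (t : ℂ) * v) (nhds 0) (nhds z) := by
    simpa using (hline 0).continuousAt.tendsto
  have hquad (t : ℝ) : HasDerivAt (fun t : ℝ => a * t + b * t ^ 2) (a + 2 * b * t) t := by
    refine (((hasDerivAt_id t).const_mul a).add (((hasDerivAt_id t).pow 2).const_mul b)).congr_deriv ?_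
    simp
    ring
  have hev : ∀ᶠ t : ℝ in nhds 0,
      HasDerivAt φ (fderiv ℝ f (z + (t : ℂ) * v) v + (a + 2 * b * t)) t := by
    have hd : ∀ᶠ y in nhds z, DifferentiableAt ℝ f y :=
      (hf.eventually (by simp)).mono fun y hy => hy.differentiableAt (by simp)
    filter_upwards [hline0.eventually hd] with t ht
    exact (ht.hasFDerivAt.comp_hasDerivAt t (hline t)).add (hquad t)
  have hderiv : deriv φ =ᶠ[nhds 0]
      fun t : ℝ => fderiv ℝ f (z + (t : ℂ) * v) v + (a + 2 * b * t) :=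
    hev.mono fun t ht => ht.deriv
  have hsecond : HasDerivAt (fun t : ℝ => fderiv ℝ f (z + (t : ℂ) * v) v + (a + 2 * b * t))
      (fderiv ℝ (fun y => fderiv ℝ f y v) z v + 2 * b) 0 := by
    have h1 : DifferentiableAt ℝ (fun y => fderiv ℝ f y v) z :=
      ((hf.fderiv_right (m := 1) (by norm_num)).differentiableAt (by simp)).clm_apply
        (differentiableAt_const v)
    have h2 : HasFDerivAt (fun y => fderiv ℝ f y v) (fderiv ℝ (fun y => fderiv ℝ f y v) z)
        (z + ((0 : ℝ) : ℂ) * v) := by simpa using h1.hasFDerivAt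
    refine (h2.comp_hasDerivAt (0 : ℝ) (hline 0)).add ?_
    simpa using ((hasDerivAt_id (0 : ℝ)).const_mul (2 * b)).const_add a
  have hdd : deriv (deriv φ) 0 = fderiv ℝ (fun y => fderiv ℝ f y v) z v + 2 * b :=
    hderiv.deriv_eq.trans hsecond.deriv
  by_contra! hpos
  have hmin : IsLocalMin φ 0 :=
    isLocalMin_of_deriv_deriv_pos (hdd ▸ hpos) hmax.deriv_eq_zero hev.self_of_nhds.continuousAt
  have hconst : φ =ᶠ[nhds 0] fun _ => φ 0 := by
    filter_upwards [hmax, hmin] with t h1 h2 using le_antisymm h1 h2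
  have : deriv (deriv φ) 0 = 0 := by
    rw [hconst.deriv.deriv_eq]; simp
  linarith

/-- The weak maximum principle on a bounded open set. -/
theorem HarmonicOnSet.le_of_forall_frontier_le {f : ℂ → ℝ} {Ω : Set ℂ} (hΩo : IsOpen Ω)
    (hΩb : Bornology.IsBounded Ω) (hf : HarmonicOnSet f Ω) (hc : ContinuousOn f (closure Ω))
    {M : ℝ} (hM : ∀ y ∈ frontier Ω, f y ≤ M) {x : ℂ} (hx : x ∈ Ω) : f x ≤ M := by
  by_contra! hlt
  obtain ⟨R, hR0, hR⟩ := hΩb.closure.exists_pos_norm_le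
  set ε := (f x - M) / (2 * R ^ 2) with hε
  have hε0 : 0 < ε := div_pos (by linarith) (by positivity)
  have hεR : ε * R ^ 2 = (f x - M) / 2 := by rw [hε]; field_simp
  obtain ⟨z, hz, hzmax⟩ := hΩb.isCompact_closure.exists_isMaxOn ⟨x, subset_closure hx⟩
    (hc.add ((Complex.continuous_re.pow 2).const_mul ε).continuousOn)
  have hzΩ : z ∈ Ω := by
    by_contra hzΩ
    have h1 := hM z ⟨hz, by rwa [hΩo.interior_eq]⟩
    have h2 : f x + ε * x.re ^ 2 ≤ f z + ε * z.re ^ 2 := hzmax (subset_closure hx)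
    have h3 : z.re ^ 2 ≤ R ^ 2 :=
      sq_le_sq.2 (((Complex.abs_re_le_norm z).trans (hR z hz)).trans (le_abs_self R))
    have h4 : ε * z.re ^ 2 ≤ ε * R ^ 2 := by gcongr
    have h5 : 0 ≤ ε * x.re ^ 2 := by positivity
    linarith
  have hdiff : ContDiffAt ℝ 2 f z := hf.1.contDiffAt (hΩo.mem_nhds hzΩ)
  have hray (v : ℂ) : ∀ᶠ t : ℝ in nhds 0, z + (t : ℂ) * v ∈ closure Ω := by
    have : Tendsto (fun t : ℝ => z + (t : ℂ) * v) (nhds 0) (nhds z) :=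
      Continuous.tendsto' (by fun_prop) _ _ (by simp)
    exact (this.eventually (hΩo.mem_nhds hzΩ)).mono fun t ht => subset_closure ht
  have hre := fderiv_fderiv_le_of_isLocalMax (v := 1) (a := 2 * ε * z.re) (b := ε) hdiff (by
    filter_upwards [hray 1] with t ht
    have h : f (z + t * 1) + ε * (z + t * 1).re ^ 2 ≤ f z + ε * z.re ^ 2 := hzmax ht
    simp only [Complex.add_re, mul_one, Complex.ofReal_re] at h ⊢
    simp only [Complex.ofReal_zero, add_zero]
    nlinarith)
  have him := fderiv_fderiv_le_of_isLocalMax (v := Complex.I) (a := 0) (b := 0) hdiff (by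
    filter_upwards [hray Complex.I] with t ht
    have h : f (z + t * Complex.I) + ε * (z + t * Complex.I).re ^ 2 ≤ f z + ε * z.re ^ 2 :=
      hzmax ht
    simpa using h)
  have := hf.2 z hzΩ
  unfold planeLap at this
  linarith

theorem exists_inBlk {m N : ℕ} {Nr : Fin m → ℕ} (hN : N = ∑ r, Nr r) (j : Fin N) :
    ∃ r, inBlk Nr r j := by
  have key : ∀ n : ℕ, n ≤ m → (j : ℕ) < ∑ s ∈ Finset.univ.filter (fun s : Fin m => (s : ℕ) < n), Nr s →
      ∃ r, inBlk Nr r j := by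
    intro n
    induction n with
    | zero => intro _ h; simp at h
    | succ n ih =>
      intro hn h
      by_cases hlt : (j : ℕ) < ∑ s ∈ Finset.univ.filter (fun s : Fin m => (s : ℕ) < n), Nr s
      · exact ih (by omega) hlt
      · have hlo : blkLo Nr ⟨n, hn⟩ =
            ∑ s ∈ Finset.univ.filter (fun s : Fin m => (s : ℕ) < n), Nr s := rfl
        have hins : Finset.univ.filter (fun s : Fin m => (s : ℕ) < n + 1) =
            insert ⟨n, hn⟩ (Finset.univ.filter (fun s : Fin m => (s : ℕ) < n)) := by
          ext s
          simp only [Finset.mem_filter, Finset.mem_univ, true_and, Finset.mem_insert, Fin.ext_iff]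
          omega
        rw [hins, Finset.sum_insert (by simp)] at h
        exact ⟨⟨n, hn⟩, by rw [hlo]; omega, by rw [hlo]; omega⟩
  refine key m le_rfl ?_
  rw [Finset.filter_true_of_mem fun s _ => s.2, ← hN]
  exact j.2

theorem card_filter_le_of_inBlk {m N : ℕ} {Nr : Fin m → ℕ} {b : Fin N → Fin m}
    (hb : ∀ j, inBlk Nr (b j) j) (r : Fin m) :
    (Finset.univ.filter fun k => b k = r).card ≤ Nr r := by
  have h := Finset.card_le_card_of_injOn (s := Finset.univ.filter fun k => b k = r)
    (t := Finset.Ico (blkLo Nr r) (blkLo Nr r + Nr r)) (fun k => (k : ℕ))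
    (fun k hk => by
      obtain rfl : b k = r := by simpa using hk
      simpa [inBlk] using hb k)
    (fun _ _ _ _ h => Fin.ext h)
  simpa using h

/-- The distance from a point on a ray to any other ray with the same vertex. -/
theorem mul_abs_sin_le_norm_sub (s t a b : ℝ) (hs : 0 ≤ s) :
    s * |sin (a - b)| ≤
      ‖(s : ℂ) * Complex.exp ((a : ℂ) * Complex.I) - t * Complex.exp ((b : ℂ) * Complex.I)‖ := by
  have hrot : ((s : ℂ) * Complex.exp ((a : ℂ) * Complex.I) - t * Complex.exp ((b : ℂ) * Complex.I))
      = Complex.exp ((b : ℂ) * Complex.I) *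
        (s * Complex.exp (((a - b : ℝ) : ℂ) * Complex.I) - t) := by
    rw [mul_sub, mul_left_comm, ← Complex.exp_add]
    push_cast
    ring_nf
  rw [hrot, norm_mul, Complex.norm_exp_ofReal_mul_I, one_mul]
  refine le_trans (le_of_eq ?_) (Complex.abs_im_le_norm _)
  rw [Complex.sub_im, Complex.im_ofReal_mul, Complex.exp_ofReal_mul_I_im, Complex.ofReal_im,
    sub_zero, abs_mul, abs_of_nonneg hs]

theorem sin_le_abs_sin {x y : ℝ} (hx : 0 ≤ x) (hxy : x ≤ |y|) (hy : |y| ≤ π / 2) :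
    sin x ≤ |sin y| := by
  have h : sin x ≤ sin |y| := sin_le_sin_of_le_of_le_pi_div_two (by linarith [pi_pos]) hy hxy
  rcases abs_cases y with ⟨e, _⟩ | ⟨e, _⟩ <;> rw [e] at h
  · exact h.trans (le_abs_self _)
  · rw [sin_neg] at h
    exact h.trans (neg_le_abs _)

/-- Bounded parts of two disjoint cones have positive distance. -/
theorem exists_pos_le_norm_sub_of_disjoint_coneAt {θ : ℂ → ℝ} {δ : ℝ} {p q : ℂ} (D : ℝ)
    (h : Disjoint (coneAt θ δ p) (coneAt θ δ q)) :
    ∃ ε > 0, ∀ x ∈ coneAt θ δ p, ∀ y ∈ coneAt θ δ q, ‖x - p‖ ≤ D → ‖y - q‖ ≤ D →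
      ε ≤ ‖x - y‖ := by
  let F : ℂ → ℝ × ℝ → ℂ := fun p u =>
    p + (u.1 : ℂ) * Complex.exp (((θ p + u.2 : ℝ) : ℂ) * Complex.I)
  let K : ℂ → Set ℂ := fun p => F p '' (Icc 0 D ×ˢ Icc (-δ) δ)
  have hK (p : ℂ) : IsCompact (K p) :=
    (isCompact_Icc.prod isCompact_Icc).image (by fun_prop)
  have hsub (p : ℂ) : K p ⊆ coneAt θ δ p := by
    rintro _ ⟨u, hu, rfl⟩
    exact ⟨u.1, hu.1.1, u.2, abs_le.2 hu.2, rfl⟩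
  have hmem (p x : ℂ) (hx : x ∈ coneAt θ δ p) (hD : ‖x - p‖ ≤ D) : x ∈ K p := by
    obtain ⟨ρ, hρ, t, ht, rfl⟩ := hx
    rw [add_sub_cancel_left, norm_mul, Complex.norm_exp_ofReal_mul_I, mul_one,
      Complex.norm_of_nonneg hρ] at hD
    exact ⟨(ρ, t), ⟨⟨hρ, hD⟩, abs_le.1 ht⟩, rfl⟩
  obtain ⟨ε, hε, hlt⟩ := Metric.exists_pos_forall_lt_edist (hK p) (hK q).isClosed
    (h.mono (hsub p) (hsub q))
  refine ⟨ε, hε, fun x hx y hy hxD hyD => ?_⟩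
  have := hlt x (hmem p x hx hxD) y (hmem q y hy hyD)
  rw [edist_nndist, ENNReal.coe_lt_coe] at this
  rw [← dist_eq_norm]
  exact_mod_cast this.le

theorem green_le {H : ℂ → ℂ → ℝ} {x y : ℂ} {M c : ℝ} (hH : H x y ≤ M) (hc : 0 < c)
    (hxy : c ≤ ‖x - y‖) : green H x y ≤ 1 / (2 * π) * log (1 / c) + M := by
  unfold green
  have : log (1 / ‖x - y‖) ≤ log (1 / c) :=
    log_le_log (one_div_pos.2 (hc.trans_le hxy)) (one_div_le_one_div_of_le hc hxy)
  gcongr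

theorem RegPart.le_of_norm_sub_le {Ω : Set ℂ} {H : ℂ → ℂ → ℝ} (hH : RegPart Ω H)
    (hΩo : IsOpen Ω) (hΩb : Bornology.IsBounded Ω) {D : ℝ}
    (hD : ∀ x ∈ closure Ω, ∀ y ∈ closure Ω, ‖x - y‖ ≤ D) {x y : ℂ} (hx : x ∈ Ω) (hy : y ∈ Ω) :
    H x y ≤ 1 / (2 * π) * log D := by
  obtain ⟨hharm, hcont, hbd⟩ := hH.1 x hx
  refine hharm.le_of_forall_frontier_le hΩo hΩb hcont (fun w hw => ?_) hy
  have hne : x ≠ w := by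
    rintro rfl
    exact hw.2 (by rwa [hΩo.interior_eq])
  have h0 : 0 < ‖x - w‖ := norm_pos_iff.2 (sub_ne_zero.2 hne)
  have := log_le_log h0 (hD x (subset_closure hx) w hw.1)
  rw [hbd w hw]
  gcongr

theorem RegPart.exists_le_of_mem {Ω : Set ℂ} {H : ℂ → ℂ → ℝ} (hH : RegPart Ω H)
    (hΩb : Bornology.IsBounded Ω) {p : ℂ} (hp : p ∈ Ω) : ∃ B, ∀ x ∈ Ω, B ≤ H x p := by
  obtain ⟨B, hB⟩ := (hΩb.isCompact_closure.image_of_continuousOn (hH.1 p hp).2.1).bddBelow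
  refine ⟨B, fun x hx => ?_⟩
  rw [hH.2 x hx p hp]
  exact hB ⟨x, subset_closure hx, rfl⟩

/-- Ψ is bounded above, uniformly, over configurations in ℳ whose
components lie on the prescribed rays emanating from the singular points p_r. -/
theorem psi_bounded_on_rays (Ω : Set ℂ) (hΩo : IsOpen Ω) (hΩc : IsConnected Ω)
    (hΩb : Bornology.IsBounded Ω) (H : ℂ → ℂ → ℝ) (hH : RegPart Ω H)
    (Z : Finset ℂ) (hZ : (Z : Set ℂ) ⊆ Ω) (α : ℂ → ℝ) (hα : ∀ p ∈ Z, 0 < α p)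
    (N : ℕ) (hN : 1 ≤ N) (θ : ℂ → ℝ) (δ : ℝ) (hδ0 : 0 < δ) (hδπ : δ < π / 2)
    (hcones : ∀ p ∈ Z, ∀ q ∈ Z, p ≠ q → Disjoint (coneAt θ δ p) (coneAt θ δ q))
    (hdist : ∀ p ∈ Z, 2 * δ < Metric.infDist p (frontier Ω))
    (hsepZ : ∀ p ∈ Z, ∀ q ∈ Z, p ≠ q → 4 * δ < ‖p - q‖)
    (m : ℕ) (hm : 1 ≤ m) (P : Fin m → ℂ) (hPinj : Function.Injective P)
    (hPZ : ∀ r, P r ∈ Z) (Nr : Fin m → ℕ) (hNr1 : ∀ r, 1 ≤ Nr r)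
    (hNrα : ∀ r, (Nr r : ℝ) < 1 + α (P r)) (hNsum : N = ∑ r, Nr r) :
    ∃ C > (0 : ℝ), ∀ ξ : Fin N → ℂ, memM Ω Z ξ → onRays θ δ P Nr ξ →
      PsiFun H Z α ξ ≤ C := by
  obtain ⟨D, hD1, hD⟩ : ∃ D : ℝ, 1 ≤ D ∧ ∀ x ∈ closure Ω, ∀ y ∈ closure Ω, ‖x - y‖ ≤ D :=
    ⟨max 1 (diam (closure Ω)), le_max_left _ _, fun x hx y hy => by
      rw [← dist_eq_norm]
      exact (dist_le_diam_of_mem hΩb.closure hx hy).trans (le_max_right _ _)⟩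
  have hD' : ∀ x ∈ Ω, ∀ y ∈ Ω, ‖x - y‖ ≤ D := fun x hx y hy =>
    hD x (subset_closure hx) y (subset_closure hy)
  set M := 1 / (2 * π) * log D with hMdef
  have hM0 : 0 ≤ M := mul_nonneg (by positivity) (log_nonneg hD1)
  have hHM : ∀ x ∈ Ω, ∀ y ∈ Ω, H x y ≤ M := fun x hx y hy =>
    hH.le_of_norm_sub_le hΩo hΩb hD hx hy
  obtain ⟨B, hB⟩ : ∃ B, ∀ p ∈ Z, ∀ x ∈ Ω, -B ≤ H x p := by
    choose! f hf using fun p (hp : p ∈ Z) => hH.exists_le_of_mem hΩb (hZ hp)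
    obtain ⟨B, hB⟩ := (Z.image fun p => -f p).bddAbove
    refine ⟨B, fun p hp x hx => ?_⟩
    have := hB (Finset.mem_coe.2 (Finset.mem_image_of_mem _ hp))
    have := hf p hp x hx
    linarith
  obtain ⟨ε, hε0, hε⟩ : ∃ ε > 0, ∀ r s, r ≠ s → ∀ x ∈ coneAt θ δ (P r), ∀ y ∈ coneAt θ δ (P s),
      ‖x - P r‖ ≤ D → ‖y - P s‖ ≤ D → ε ≤ ‖x - y‖ := by
    choose! f hf0 hf using fun (u : Fin m × Fin m) (hu : u.1 ≠ u.2) =>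
      exists_pos_le_norm_sub_of_disjoint_coneAt D
        (hcones _ (hPZ u.1) _ (hPZ u.2) (hPinj.ne hu))
    have hsmall : ∀ᶠ ε : ℝ in nhdsWithin 0 (Ioi 0), ∀ u : Fin m × Fin m, u.1 ≠ u.2 → ε ≤ f u :=
      eventually_all.2 fun u => eventually_imp_distrib_left.2 fun hu =>
        nhdsWithin_le_nhds (eventually_le_nhds (hf0 u hu))
    obtain ⟨ε, hε, hε0⟩ := (hsmall.and self_mem_nhdsWithin).exists
    exact ⟨ε, hε0, fun r s hrs x hx y hy hxD hyD =>
      (hε (r, s) hrs).trans (hf (r, s) hrs x hx y hy hxD hyD)⟩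
  choose b hb using fun j : Fin N => exists_inBlk hNsum j
  have hNpos : (0 : ℝ) < N := by exact_mod_cast hN
  set c := sin (δ / N) with hcdef
  have hδN : δ / N ≤ δ := div_le_self hδ0.le (by exact_mod_cast hN)
  have hc0 : 0 < c := sin_pos_of_pos_of_lt_pi (by positivity) (by linarith [pi_pos])
  -- bounds for the Green's function inside a block and across blocks, and the final constant
  set C₁ := 1 / (2 * π) * log (1 / c) with hC₁
  set C₂ := 1 / (2 * π) * log (1 / ε) + M with hC₂
  set E := |C₁| + |C₂| + |B| + M with hE
  have hE0 : 0 ≤ E := by positivity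
  set C := (1 / 2) * E + (∑ p ∈ Z, (α p / 2) * E) + 1 / 2 * (N * E) with hC
  have hterm : ∀ ξ : Fin N → ℂ, memM Ω Z ξ → onRays θ δ P Nr ξ → ∀ j,
      1 / 2 * H (ξ j) (ξ j) - ∑ p ∈ Z, α p / 2 * green H (ξ j) p +
        1 / 2 * ∑ k, (if j ≠ k then green H (ξ j) (ξ k) else 0) ≤ C := by
    intro ξ hξ hrays j
    have hΩ k : ξ k ∈ Ω := (hξ.1 k).1
    have hpos (p) (hp : p ∈ Z) : 0 < ‖ξ j - p‖ :=
      norm_pos_iff.2 (sub_ne_zero.2 fun h => (hξ.1 j).2 (h ▸ hp))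
    set ρ := ‖ξ j - P (b j)‖ with hρ
    have hρ0 : 0 < ρ := hpos _ (hPZ _)
    set L := 1 / (2 * π) * log (1 / ρ) + M with hL
    have hlog (p) (hp : p ∈ Z) : 0 ≤ 1 / (2 * π) * log (1 / ‖ξ j - p‖) + M := by
      have : log ‖ξ j - p‖ ≤ log D := log_le_log (hpos p hp) (hD' _ (hΩ j) _ (hZ hp))
      rw [hMdef, ← mul_add, one_div ‖_‖, log_inv]
      exact mul_nonneg (by positivity) (by linarith)
    have hL0 : 0 ≤ L := hlog _ (hPZ _)
    have hcone k : ξ k ∈ coneAt θ δ (P (b k)) := by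
      refine ⟨_, norm_nonneg (ξ k - P (b k)), ((k : ℕ) + 1) * δ / N, ?_, ?_⟩
      · have hk : ((k : ℕ) + 1 : ℝ) ≤ N := by exact_mod_cast k.2
        rw [abs_of_nonneg (by positivity), div_le_iff₀ hNpos]
        nlinarith
      · rw [← hrays _ k (hb k)]; ring
    have hsame k (hk : b k = b j) (hjk : j ≠ k) : green H (ξ j) (ξ k) ≤ L + E := by
      have hdist : ρ * c ≤ ‖ξ j - ξ k‖ := by
        have hj := hrays _ j (hb j)
        have hk' := hrays _ k (hb k)
        rw [hk] at hk'
        have hsub : ξ j - ξ k = (ξ j - P (b j)) - (ξ k - P (b j)) := by ring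
        rw [hsub, hj, hk']
        refine le_trans ?_ (mul_abs_sin_le_norm_sub _ _ _ _ (norm_nonneg _))
        have hdiff : θ (P (b j)) + ((j : ℕ) + 1) * δ / N - (θ (P (b j)) + ((k : ℕ) + 1) * δ / N)
            = (((j : ℕ) : ℝ) - (k : ℕ)) * (δ / N) := by ring
        have habs1 : (1 : ℝ) ≤ |((j : ℕ) : ℝ) - (k : ℕ)| := by
          have : (1 : ℤ) ≤ |((j : ℕ) : ℤ) - (k : ℕ)| :=
            Int.one_le_abs (sub_ne_zero.2 fun h => hjk (Fin.ext (by exact_mod_cast h)))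
          exact_mod_cast this
        have habs2 : |((j : ℕ) : ℝ) - (k : ℕ)| ≤ N := by
          have h1 : ((j : ℕ) : ℝ) ≤ N := by exact_mod_cast j.2.le
          have h2 : ((k : ℕ) : ℝ) ≤ N := by exact_mod_cast k.2.le
          rw [abs_le]
          constructor <;> linarith [Nat.cast_nonneg (α := ℝ) (j : ℕ), Nat.cast_nonneg (α := ℝ) (k : ℕ)]
        have hδN0 : 0 ≤ δ / N := by positivity
        rw [hdiff]
        refine mul_le_mul_of_nonneg_left (sin_le_abs_sin hδN0 ?_ ?_) (norm_nonneg _)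
        · rw [abs_mul, abs_of_nonneg hδN0]
          nlinarith
        · rw [abs_mul, abs_of_nonneg hδN0]
          have : (N : ℝ) * (δ / N) = δ := by field_simp
          nlinarith
      have h := green_le (hHM _ (hΩ j) _ (hΩ k)) (mul_pos hρ0 hc0) hdist
      have hsplit : log (1 / (ρ * c)) = log (1 / ρ) + log (1 / c) := by
        rw [one_div, mul_inv, log_mul (by positivity) (by positivity), one_div, one_div]
      rw [hsplit, mul_add] at h
      have := le_abs_self C₁
      have := abs_nonneg C₂
      have := abs_nonneg B
      linarith
    have hother k (hk : b k ≠ b j) : green H (ξ j) (ξ k) ≤ E := by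
      have h := green_le (hHM _ (hΩ j) _ (hΩ k)) hε0 (hε _ _ hk.symm _ (hcone j) _ (hcone k)
        (hD' _ (hΩ j) _ (hZ (hPZ _))) (hD' _ (hΩ k) _ (hZ (hPZ _))))
      have := le_abs_self C₂
      have := abs_nonneg C₁
      have := abs_nonneg B
      linarith
    have hpair : ∑ k, (if j ≠ k then green H (ξ j) (ξ k) else 0) ≤ (Nr (b j) - 1) * L + N * E := by
      have hle : ∀ k, (if j ≠ k then green H (ξ j) (ξ k) else 0) ≤
          ((if b k = b j then L else 0) - (if j = k then L else 0)) + E := by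
        intro k
        by_cases hjk : j = k
        · subst hjk; simpa using hE0
        · by_cases hk : b k = b j
          · simpa [hjk, hk] using hsame k hk hjk
          · simpa [hjk, hk] using hother k hk
      refine (Finset.sum_le_sum fun k _ => hle k).trans ?_
      rw [Finset.sum_add_distrib, Finset.sum_sub_distrib, ← Finset.sum_filter, Finset.sum_const,
        Finset.sum_ite_eq, Finset.sum_const]
      simp only [Finset.mem_univ, if_true, nsmul_eq_mul, Finset.card_univ, Fintype.card_fin]
      have : ((Finset.univ.filter fun k => b k = b j).card : ℝ) ≤ Nr (b j) := by
        exact_mod_cast card_filter_le_of_inBlk hb (b j)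
      nlinarith
    have hsing : -∑ p ∈ Z, α p / 2 * green H (ξ j) p ≤
        ∑ p ∈ Z, (α p / 2) * E - α (P (b j)) / 2 * L := by
      have hle : ∀ p ∈ Z, -(α p / 2 * green H (ξ j) p) ≤
          α p / 2 * E - (if p = P (b j) then α p / 2 * L else 0) := by
        intro p hp
        have hαp := hα p hp
        have hBE : B + M ≤ E := by
          have := abs_nonneg C₁
          have := abs_nonneg C₂
          have := le_abs_self B
          linarith
        have hBp := hB p hp _ (hΩ j)
        have hg : 1 / (2 * π) * log (1 / ‖ξ j - p‖) + M - E ≤ green H (ξ j) p := by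
          unfold green; linarith
        split_ifs with h
        · subst h
          have : α (P (b j)) / 2 * (L - E) ≤ α (P (b j)) / 2 * green H (ξ j) (P (b j)) :=
            mul_le_mul_of_nonneg_left hg (by positivity)
          linarith
        · have : α p / 2 * (-E) ≤ α p / 2 * green H (ξ j) p :=
            mul_le_mul_of_nonneg_left (by linarith [hlog p hp]) (by positivity)
          linarith
      rw [← Finset.sum_neg_distrib]
      refine (Finset.sum_le_sum hle).trans (le_of_eq ?_)
      rw [Finset.sum_sub_distrib, Finset.sum_ite_eq' Z (P (b j)) fun p => α p / 2 * L,
        if_pos (hPZ _)]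
    have hα' := hNrα (b j)
    have hHj := hHM _ (hΩ j) _ (hΩ j)
    have hME : M ≤ E := by
      have := abs_nonneg C₁
      have := abs_nonneg C₂
      have := abs_nonneg B
      linarith
    have hneg : (Nr (b j) - 1 - α (P (b j))) * L ≤ 0 :=
      mul_nonpos_of_nonpos_of_nonneg (by linarith) hL0
    linarith
  refine ⟨N * |C| + 1, by positivity, fun ξ hξ hrays => ?_⟩
  have hsum : PsiFun H Z α ξ = ∑ j, (1 / 2 * H (ξ j) (ξ j) - ∑ p ∈ Z, α p / 2 * green H (ξ j) p +
        1 / 2 * ∑ k, (if j ≠ k then green H (ξ j) (ξ k) else 0)) := by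
    rw [PsiFun, Finset.sum_add_distrib, Finset.sum_sub_distrib, Finset.sum_comm (t := Z)]
    simp only [Finset.mul_sum]
  rw [hsum]
  refine (Finset.sum_le_sum fun j _ => (hterm ξ hξ hrays j).trans (le_abs_self C)).trans ?_
  simp
end

section
/- Let ξ_n = (ξ₁ⁿ,…,ξ_Nⁿ) be a sequence in ℳ such that the sequence (Ψ(ξ_n)) is bounded and min_{j≠k}|ξ_jⁿ − ξ_kⁿ| → 0 as n → ∞. Then there exist indices j₀ ≠ k₀ and a subsequence along which |ξ_{j₀}ⁿ − ξ_{k₀}ⁿ| / d(ξ_{j₀}ⁿ) → 0, where d(x) = dist(x, ∂Ω). -/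
open Real Set Metric Filter MeasureTheory

/-- The standard inner product on ℝ² ≅ ℂ. -/
noncomputable def rinner (z w : ℂ) : ℝ := z.re * w.re + z.im * w.im

/-- The collar Ω₀ = {x ∈ Ω : dist(x,∂Ω) < δ₀}. -/
def collar (Ω : Set ℂ) (δ₀ : ℝ) : Set ℂ :=
  {x | x ∈ Ω ∧ Metric.infDist x (frontier Ω) < δ₀}

/-- `Ω has C² boundary`: there are δ₀ > 0 and C₀ > 0 such that the nearest-point
projection onto ∂Ω is well defined and C¹ on the collar Ω₀, and the inward unit
normal ν satisfies |⟨z − w, ν_w⟩| ≤ C₀|z − w|² for w, z ∈ ∂Ω. -/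
structure C2Boundary (Ω : Set ℂ) where
  δ₀ : ℝ
  C₀ : ℝ
  proj : ℂ → ℂ
  ν : ℂ → ℂ
  δ₀_pos : 0 < δ₀
  C₀_pos : 0 < C₀
  proj_mem : ∀ x ∈ collar Ω δ₀, proj x ∈ frontier Ω
  proj_dist : ∀ x ∈ collar Ω δ₀, ‖x - proj x‖ = Metric.infDist x (frontier Ω)
  proj_unique : ∀ x ∈ collar Ω δ₀, ∀ z ∈ frontier Ω,
    ‖x - z‖ = Metric.infDist x (frontier Ω) → z = proj x
  proj_C1 : ContDiffOn ℝ 1 proj (collar Ω δ₀)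
  ν_unit : ∀ w ∈ frontier Ω, ‖ν w‖ = 1
  ν_compat : ∀ x ∈ collar Ω δ₀, ν (proj x) = (‖x - proj x‖)⁻¹ • (x - proj x)
  quad : ∀ w ∈ frontier Ω, ∀ z ∈ frontier Ω, |rinner (z - w) (ν w)| ≤ C₀ * ‖z - w‖ ^ 2

/-- The reflection x̄ = 2p(x) − x of x across ∂Ω. -/
noncomputable def C2Boundary.refl {Ω : Set ℂ} (b : C2Boundary Ω) (x : ℂ) : ℂ :=
  2 * b.proj x - x

/-- The inward unit normal ν_x = (x − p(x))/|x − p(x)| at p(x). -/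
noncomputable def C2Boundary.nuAt {Ω : Set ℂ} (b : C2Boundary Ω) (x : ℂ) : ℂ :=
  (‖x - b.proj x‖)⁻¹ • (x - b.proj x)

open InnerProductSpace in
/-- The weak maximum principle for harmonic functions on a bounded open subset of the plane. -/
theorem harmonicOnNhd_le_of_frontier_le {U : Set ℂ} (hUo : IsOpen U)
    (hUb : Bornology.IsBounded U) {u : ℂ → ℝ} (hu : HarmonicOnNhd u U)
    (hc : ContinuousOn u (closure U)) {M : ℝ} (hM : ∀ y ∈ frontier U, u y ≤ M) :
    ∀ y ∈ U, u y ≤ M := by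
  intro y hy
  have hcomp : IsCompact (closure U) := hUb.isCompact_closure
  obtain ⟨z, hz, hmax⟩ := hcomp.exists_isMaxOn ⟨y, subset_closure hy⟩ hc
  by_contra! hlt
  have hyz : u y ≤ u z := hmax (subset_closure hy)
  set K : Set ℂ := closure U ∩ u ⁻¹' {u z} with hK
  have hKc : IsClosed K := hc.preimage_isClosed_of_isClosed isClosed_closure isClosed_singleton
  have hKU : K ⊆ U := by
    rintro w ⟨hw, hwz⟩
    by_contra hwU
    have hwM := hM w (by rw [hUo.frontier_eq]; exact ⟨hw, hwU⟩)
    have hwz' : u w = u z := hwz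
    linarith
  have hKo : IsOpen K := by
    rw [isOpen_iff_mem_nhds]
    intro w hw
    have hwz : u w = u z := hw.2
    obtain ⟨r, hr, hball⟩ := Metric.isOpen_iff.1 hUo w (hKU hw)
    obtain ⟨F, hF, hFu⟩ := (hu.mono hball).exists_analyticOnNhd_ball_re_eq
    have hnear : ∀ᶠ v in nhds w, v ∈ ball w r := ball_mem_nhds w hr
    have hnorm : ∀ v ∈ ball w r, ‖Complex.exp (F v)‖ = Real.exp (u v) := by
      intro v hv
      rw [Complex.norm_exp]
      congr 1
      exact hFu hv
    have hd : ∀ᶠ v in nhds w, DifferentiableAt ℂ (fun v => Complex.exp (F v)) v := by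
      filter_upwards [hnear] with v hv
      exact (hF v hv).differentiableAt.cexp
    have hloc : IsLocalMax (norm ∘ fun v => Complex.exp (F v)) w := by
      filter_upwards [hnear] with v hv
      simp only [Function.comp_apply]
      rw [hnorm v hv, hnorm w (mem_ball_self hr), Real.exp_le_exp, hwz]
      exact hmax (subset_closure (hball hv))
    filter_upwards [hnear, Complex.norm_eventually_eq_of_isLocalMax hd hloc] with v hv hvw
    refine ⟨subset_closure (hball hv), ?_⟩
    rw [hnorm v hv, hnorm w (mem_ball_self hr), Real.exp_eq_exp, hwz] at hvw
    exact hvw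
  have hKuniv : K = univ := by
    have hzU : z ∈ K := ⟨hz, rfl⟩
    exact (isClopen_iff.1 ⟨hKc, hKo⟩).resolve_left (Set.Nonempty.ne_empty ⟨z, hzU⟩)
  exact noncompact_univ ℂ (hKuniv ▸ hcomp.of_isClosed_subset hKc inter_subset_left)

theorem planeLap_eq_laplacian {f : ℂ → ℝ} {x : ℂ} (hf : ContDiffAt ℝ 2 f x) :
    planeLap f x = Laplacian.laplacian f x := by
  have hd : DifferentiableAt ℝ (fderiv ℝ f) x :=
    (hf.fderiv_right (m := 1) (by norm_num)).differentiableAt (by norm_num)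
  rw [InnerProductSpace.laplacian_eq_iteratedFDeriv_complexPlane]
  simp only [iteratedFDeriv_two_apply, planeLap]
  rw [fderiv_clm_apply hd (differentiableAt_const _), fderiv_clm_apply hd (differentiableAt_const _)]
  simp

theorem HarmonicOnSet.harmonicOnNhd {f : ℂ → ℝ} {s : Set ℂ} (hs : IsOpen s)
    (hf : HarmonicOnSet f s) : InnerProductSpace.HarmonicOnNhd f s := by
  intro x hx
  refine ⟨hf.1.contDiffAt (hs.mem_nhds hx), ?_⟩
  filter_upwards [hs.mem_nhds hx] with y hy
  rw [← planeLap_eq_laplacian (hf.1.contDiffAt (hs.mem_nhds hy)), hf.2 y hy]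
  rfl

theorem harmonicOnNhd_log_norm_sub (a : ℂ) {s : Set ℂ} (ha : a ∉ s) :
    InnerProductSpace.HarmonicOnNhd (fun y => (1 / (2 * π)) * Real.log ‖y - a‖) s := by
  intro y hy
  have hya : y - a ≠ 0 := sub_ne_zero.2 fun h => ha (h ▸ hy)
  have h : AnalyticAt ℂ (fun y : ℂ => y - a) y := analyticAt_id.sub analyticAt_const
  exact (h.harmonicAt_log_norm hya).const_smul (c := 1 / (2 * π))

theorem continuousOn_log_norm_sub (a : ℂ) {s : Set ℂ} (ha : a ∉ s) :
    ContinuousOn (fun y => (1 / (2 * π)) * Real.log ‖y - a‖) s := by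
  refine continuousOn_const.mul (ContinuousOn.log (by fun_prop) ?_)
  intro y hy
  exact norm_ne_zero_iff.2 (sub_ne_zero.2 fun h => ha (h ▸ hy))

/-- The Dirichlet Green's function is nonnegative. -/
theorem RegPart.green_nonneg {Ω : Set ℂ} (hΩo : IsOpen Ω) (hΩb : Bornology.IsBounded Ω)
    {H : ℂ → ℂ → ℝ} (hH : RegPart Ω H) {x y : ℂ} (hx : x ∈ Ω) (hy : y ∈ Ω) (hxy : x ≠ y) :
    0 ≤ green H x y := by
  obtain ⟨hharm, hcont, hbdry⟩ := hH.1 x hx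
  obtain ⟨m, hm⟩ := hΩb.isCompact_closure.bddBelow_image hcont
  have hm' : ∀ z ∈ closure Ω, m ≤ H x z := fun z hz => hm ⟨z, hz, rfl⟩
  have hpi : (0 : ℝ) < 2 * π := by positivity
  set ε := min (‖y - x‖ / 2) (Real.exp (2 * π * m)) with hε
  have hyx : 0 < ‖y - x‖ := norm_pos_iff.2 (sub_ne_zero.2 hxy.symm)
  have hε0 : 0 < ε := by positivity
  have hlogε : (1 / (2 * π)) * Real.log ε ≤ m := by
    have h1 : Real.log ε ≤ 2 * π * m := by
      rw [Real.log_le_iff_le_exp hε0]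
      exact min_le_right _ _
    rw [one_div, inv_mul_le_iff₀ hpi]
    exact h1
  set U := Ω \ closedBall x ε with hU
  have hUo : IsOpen U := hΩo.sdiff isClosed_closedBall
  have hUcl : closure U ⊆ {z | ε ≤ ‖z - x‖} := by
    refine closure_minimal ?_ (isClosed_le continuous_const (by fun_prop))
    intro z hz
    have h := hz.2
    rw [mem_closedBall, dist_eq_norm, not_le] at h
    exact h.le
  have hUcl' : closure U ⊆ closure Ω := closure_mono sdiff_subset
  have hxU : x ∉ closure U := fun h => by
    have h1 := hUcl h
    simp only [Set.mem_ofPred_eq, sub_self, norm_zero] at h1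
    linarith
  have hle := harmonicOnNhd_le_of_frontier_le hUo (hΩb.subset sdiff_subset)
    (u := fun z => (1 / (2 * π)) * Real.log ‖z - x‖ - H x z) (M := 0)
    ((harmonicOnNhd_log_norm_sub x fun h => hxU (subset_closure h)).sub
      ((hharm.harmonicOnNhd hΩo).mono sdiff_subset))
    ((continuousOn_log_norm_sub x hxU).sub (hcont.mono hUcl')) ?_ y ?_
  · rw [green, one_div ‖x - y‖, Real.log_inv, norm_sub_rev]
    linarith
  · intro z hz
    rw [hUo.frontier_eq] at hz
    by_cases hzΩ : z ∈ Ω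
    · have h1 : ‖z - x‖ ≤ ε := by
        by_contra hlt
        exact hz.2 ⟨hzΩ, by rwa [mem_closedBall, dist_eq_norm]⟩
      have h2 : ‖z - x‖ = ε := le_antisymm h1 (hUcl hz.1)
      have h3 := hm' z (subset_closure hzΩ)
      simp only [h2]
      linarith
    · have hzf : z ∈ frontier Ω := by
        rw [hΩo.frontier_eq]
        exact ⟨hUcl' hz.1, hzΩ⟩
      simp only [hbdry z hzf, norm_sub_rev x z, sub_self, le_refl]
  · refine ⟨hy, ?_⟩
    rw [mem_closedBall, dist_eq_norm, not_le]
    have : ε ≤ ‖y - x‖ / 2 := min_le_left _ _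
    linarith

/-- Comparison of the regular part with the fundamental solution centred at a point outside
the closure of the domain. -/
theorem RegPart.le_log_of_exterior {Ω : Set ℂ} (hΩo : IsOpen Ω) (hΩb : Bornology.IsBounded Ω)
    {H : ℂ → ℂ → ℝ} (hH : RegPart Ω H) {x a : ℂ} (hx : x ∈ Ω) (ha : a ∉ closure Ω) {C : ℝ}
    (hC : 0 < C) (hCa : ∀ y ∈ frontier Ω, ‖x - y‖ ≤ C * ‖y - a‖) {y : ℂ} (hy : y ∈ Ω) :
    H x y ≤ (1 / (2 * π)) * Real.log (C * ‖y - a‖) := by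
  obtain ⟨hharm, hcont, hbdry⟩ := hH.1 x hx
  have hne : ∀ z ∈ closure Ω, ‖z - a‖ ≠ 0 := fun z hz =>
    norm_ne_zero_iff.2 (sub_ne_zero.2 fun h => ha (h ▸ hz))
  have hle := harmonicOnNhd_le_of_frontier_le hΩo hΩb
    (u := fun z => H x z - (1 / (2 * π)) * Real.log ‖z - a‖) (M := (1 / (2 * π)) * Real.log C)
    ((hharm.harmonicOnNhd hΩo).sub
      (harmonicOnNhd_log_norm_sub a fun h => ha (subset_closure h)))
    (hcont.sub (continuousOn_log_norm_sub a ha)) ?_ y hy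
  · rw [Real.log_mul hC.ne' (hne y (subset_closure hy))]
    linarith
  · intro z hz
    have hxz : 0 < ‖x - z‖ := by
      refine norm_pos_iff.2 (sub_ne_zero.2 ?_)
      rintro rfl
      rw [hΩo.frontier_eq] at hz
      exact hz.2 hx
    have h := Real.log_le_log hxz (hCa z hz)
    rw [Real.log_mul hC.ne' (hne z (frontier_subset_closure hz))] at h
    have h2 := mul_le_mul_of_nonneg_left h (show (0 : ℝ) ≤ 1 / (2 * π) by positivity)
    simp only [hbdry z hz]
    linarith

/-- The regular part is bounded above. -/
theorem RegPart.exists_le {Ω : Set ℂ} (hΩo : IsOpen Ω) (hΩb : Bornology.IsBounded Ω)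
    {H : ℂ → ℂ → ℝ} (hH : RegPart Ω H) : ∃ K : ℝ, ∀ x ∈ Ω, ∀ y ∈ Ω, H x y ≤ K := by
  refine ⟨(1 / (2 * π)) * Real.log (diam (closure Ω)), fun x hx y hy => ?_⟩
  obtain ⟨hharm, hcont, hbdry⟩ := hH.1 x hx
  refine harmonicOnNhd_le_of_frontier_le hΩo hΩb (hharm.harmonicOnNhd hΩo) hcont ?_ y hy
  intro z hz
  have hxz : 0 < ‖x - z‖ := by
    refine norm_pos_iff.2 (sub_ne_zero.2 ?_)
    rintro rfl
    rw [hΩo.frontier_eq] at hz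
    exact hz.2 hx
  rw [hbdry z hz]
  refine mul_le_mul_of_nonneg_left (Real.log_le_log hxz ?_) (by positivity)
  rw [← dist_eq_norm]
  exact dist_le_diam_of_mem hΩb.closure (subset_closure hx) (frontier_subset_closure hz)

/-- Near the boundary, the ball centred at the reflection `2 p(x) - x` with radius the distance
of `x` to the boundary misses the domain. -/
theorem C2Boundary.disjoint_ball_refl {Ω : Set ℂ} (hΩo : IsOpen Ω) (b : C2Boundary Ω) {x : ℂ}
    (hx : x ∈ Ω) (hδ : Metric.infDist x (frontier Ω) < b.δ₀)
    (hC : 2 * b.C₀ * Metric.infDist x (frontier Ω) ≤ 1) :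
    Disjoint (ball (b.refl x) (Metric.infDist x (frontier Ω))) Ω := by
  set d := Metric.infDist x (frontier Ω) with hd
  set w := b.proj x with hw
  have hxc : x ∈ collar Ω b.δ₀ := ⟨hx, hδ⟩
  have hwf : w ∈ frontier Ω := b.proj_mem x hxc
  have hxw : ‖x - w‖ = d := b.proj_dist x hxc
  have hne : x - w ≠ 0 := by
    refine sub_ne_zero.2 fun h => ?_
    rw [hΩo.frontier_eq] at hwf
    exact hwf.2 (h ▸ hx)
  have hd0 : 0 < d := hxw ▸ norm_pos_iff.2 hne
  have hν : b.ν w = d⁻¹ • (x - w) := by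
    rw [← hxw]
    exact b.ν_compat x hxc
  have hfar : ∀ z ∈ frontier Ω, d ≤ ‖z - b.refl x‖ := by
    intro z hz
    have hq := (abs_le.1 (b.quad w hwf z hz)).1
    rw [hν] at hq
    have hsq : ∀ v : ℂ, ‖v‖ ^ 2 = v.re ^ 2 + v.im ^ 2 := fun v => by
      rw [Complex.sq_norm, Complex.normSq_apply]
      ring
    have hr : rinner (z - w) (d⁻¹ • (x - w)) = d⁻¹ * rinner (z - w) (x - w) := by
      simp only [rinner, Complex.smul_re, Complex.smul_im, smul_eq_mul]
      ring
    rw [hr, ← sub_nonneg] at hq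
    have hq2 : 0 ≤ rinner (z - w) (x - w) + d * (b.C₀ * ‖z - w‖ ^ 2) := by
      have := mul_nonneg hd0.le hq
      rw [mul_sub, mul_inv_cancel_left₀ hd0.ne'] at this
      linarith
    have hexp : ‖z - b.refl x‖ ^ 2 = ‖z - w‖ ^ 2 + 2 * rinner (z - w) (x - w) + d ^ 2 := by
      rw [← hxw, hsq, hsq, hsq]
      simp only [C2Boundary.refl, ← hw, rinner, Complex.sub_re, Complex.sub_im, Complex.mul_re,
        Complex.mul_im, Complex.re_ofNat, Complex.im_ofNat]
      ring
    refine (sq_le_sq₀ hd0.le (norm_nonneg _)).1 ?_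
    rw [hexp]
    nlinarith [mul_nonneg (sub_nonneg.2 hC) (sq_nonneg ‖z - w‖)]
  have hrw : b.refl x - w = -(x - w) := by
    simp only [C2Boundary.refl, ← hw]
    ring
  by_contra hmeet
  rw [Set.not_disjoint_iff_nonempty_inter] at hmeet
  have hdisj : Disjoint (ball (b.refl x) d) (frontier Ω) := by
    rw [Set.disjoint_left]
    intro z hz hzf
    rw [mem_ball, dist_eq_norm] at hz
    exact absurd (hfar z hzf) (not_le.2 hz)
  have hsub : ball (b.refl x) d ⊆ Ω := by
    have hcover : ball (b.refl x) d ⊆ Ω ∪ (closure Ω)ᶜ := by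
      intro z hz
      by_cases hzΩ : z ∈ Ω
      · exact Or.inl hzΩ
      · refine Or.inr fun hcl => Set.disjoint_left.1 hdisj hz ?_
        rw [hΩo.frontier_eq]
        exact ⟨hcl, hzΩ⟩
    exact (convex_ball _ _).isPreconnected.subset_left_of_subset_union hΩo
      isClosed_closure.isOpen_compl (disjoint_compl_right.mono_left subset_closure) hcover hmeet
  have hinf : Metric.infDist (b.refl x) (frontier Ω) = d := by
    refine le_antisymm ?_ ((Metric.le_infDist ⟨w, hwf⟩).2 fun z hz => ?_)
    · refine (Metric.infDist_le_dist_of_mem hwf).trans ?_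
      rw [dist_eq_norm, hrw, norm_neg, hxw]
    · rw [dist_comm, dist_eq_norm]
      exact hfar z hz
  have hrc : b.refl x ∈ collar Ω b.δ₀ := ⟨hsub (mem_ball_self hd0), by rw [hinf]; exact hδ⟩
  have hwr : w = b.proj (b.refl x) :=
    b.proj_unique _ hrc w hwf (by rw [hinf, hrw, norm_neg, hxw])
  have hν' := b.ν_compat _ hrc
  rw [← hwr, hrw, norm_neg, hxw, hν, smul_neg] at hν'
  have h0 : d⁻¹ • (x - w) = 0 := self_eq_neg.1 hν'
  exact hne ((smul_eq_zero.1 h0).resolve_left (inv_ne_zero hd0.ne'))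

/-- Near the boundary, `H(x,y)` is at most of the order of `log (d(x) + |x - y|)`. -/
theorem RegPart.exists_le_log_infDist {Ω : Set ℂ} (hΩo : IsOpen Ω) (hΩb : Bornology.IsBounded Ω)
    (b : C2Boundary Ω) {H : ℂ → ℂ → ℝ} (hH : RegPart Ω H) :
    ∃ δ > 0, ∀ x ∈ Ω, Metric.infDist x (frontier Ω) < δ → ∀ y ∈ Ω,
      H x y ≤ (1 / (2 * π)) *
        Real.log (3 * (2 * Metric.infDist x (frontier Ω) + ‖x - y‖)) := by
  have hC0 := b.C₀_pos
  have hδ0 := b.δ₀_pos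
  refine ⟨min b.δ₀ (1 / (2 * b.C₀)), by positivity, fun x hx hxd y hy => ?_⟩
  set d := Metric.infDist x (frontier Ω) with hd
  have hdδ : d < b.δ₀ := hxd.trans_le (min_le_left _ _)
  have hdC : 2 * b.C₀ * d ≤ 1 := by
    have h := (hxd.trans_le (min_le_right _ _)).le
    rw [le_div_iff₀ (by positivity)] at h
    linarith
  have hdisj := b.disjoint_ball_refl hΩo hx hdδ hdC
  have hxw : ‖x - b.proj x‖ = d := b.proj_dist x ⟨hx, hdδ⟩
  have hwf := b.proj_mem x ⟨hx, hdδ⟩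
  have hd0 : 0 < d := by
    rw [← hxw]
    refine norm_pos_iff.2 (sub_ne_zero.2 fun h => ?_)
    rw [hΩo.frontier_eq] at hwf
    exact hwf.2 (h ▸ hx)
  have hcl : Disjoint (ball (b.refl x) d) (closure Ω) := hdisj.closure_right isOpen_ball
  have hfar : ∀ z ∈ closure Ω, d ≤ ‖z - b.refl x‖ := by
    intro z hz
    by_contra! hlt
    exact Set.disjoint_left.1 hcl (by rwa [mem_ball, dist_eq_norm]) hz
  have hxr : ‖x - b.refl x‖ = 2 * d := by
    have : x - b.refl x = 2 * (x - b.proj x) := by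
      simp only [C2Boundary.refl]
      ring
    rw [this, norm_mul, hxw]
    simp
  have ha : b.refl x ∉ closure Ω := fun h => Set.disjoint_left.1 hcl (mem_ball_self hd0) h
  refine (hH.le_log_of_exterior hΩo hΩb hx ha (C := 3) (by norm_num) ?_ hy).trans ?_
  · intro z hz
    have h1 := hfar z (frontier_subset_closure hz)
    have h2 := norm_sub_le_norm_sub_add_norm_sub x (b.refl x) z
    rw [norm_sub_rev (b.refl x) z] at h2
    linarith
  · have h1 := hfar y (subset_closure hy)
    have h2 := norm_sub_le_norm_sub_add_norm_sub y x (b.refl x)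
    rw [norm_sub_rev y x] at h2
    refine mul_le_mul_of_nonneg_left (Real.log_le_log ?_ ?_) (by positivity)
    · linarith
    · linarith

/-- The Green's function is bounded on pairs whose distance is at least comparable with the
distance to the boundary. -/
theorem RegPart.exists_green_le {Ω : Set ℂ} (hΩo : IsOpen Ω) (hΩb : Bornology.IsBounded Ω)
    (b : C2Boundary Ω) {H : ℂ → ℂ → ℝ} (hH : RegPart Ω H) {c : ℝ} (hc : 0 < c) :
    ∃ K : ℝ, ∀ x ∈ Ω, ∀ y ∈ Ω, x ≠ y → c * Metric.infDist x (frontier Ω) ≤ ‖x - y‖ →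
      green H x y ≤ K := by
  obtain ⟨δ, hδ, hnear⟩ := hH.exists_le_log_infDist hΩo hΩb b
  obtain ⟨K, hK⟩ := hH.exists_le hΩo hΩb
  have hpi : (0 : ℝ) ≤ 1 / (2 * π) := by positivity
  refine ⟨max ((1 / (2 * π)) * Real.log (3 * (2 / c + 1)))
    (K - (1 / (2 * π)) * Real.log (c * δ)), fun x hx y hy hxy hcd => ?_⟩
  have hpos : 0 < ‖x - y‖ := norm_pos_iff.2 (sub_ne_zero.2 hxy)
  rw [green, one_div ‖x - y‖, Real.log_inv]
  rcases lt_or_ge (Metric.infDist x (frontier Ω)) δ with h | h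
  · refine le_max_of_le_left ?_
    have h0 : 0 ≤ Metric.infDist x (frontier Ω) := Metric.infDist_nonneg
    have h1 := hnear x hx h y hy
    have h2 : 3 * (2 * Metric.infDist x (frontier Ω) + ‖x - y‖) ≤
        3 * (2 / c + 1) * ‖x - y‖ := by
      have : Metric.infDist x (frontier Ω) ≤ ‖x - y‖ / c := by
        rw [le_div_iff₀ hc]
        linarith
      have e : 3 * (2 / c + 1) * ‖x - y‖ = 3 * (2 * (‖x - y‖ / c) + ‖x - y‖) := by ring
      rw [e]
      linarith
    have h3 := Real.log_le_log (by positivity) h2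
    rw [Real.log_mul (by positivity) hpos.ne'] at h3
    have h4 := mul_le_mul_of_nonneg_left h3 hpi
    linarith
  · refine le_max_of_le_right ?_
    have h1 := hK x hx y hy
    have h2 : c * δ ≤ ‖x - y‖ := (mul_le_mul_of_nonneg_left h hc.le).trans hcd
    have h3 := mul_le_mul_of_nonneg_left (Real.log_le_log (by positivity) h2) hpi
    linarith

theorem RegPart.PsiFun_le {Ω : Set ℂ} (hΩo : IsOpen Ω) (hΩb : Bornology.IsBounded Ω)
    {H : ℂ → ℂ → ℝ} (hH : RegPart Ω H) {Z : Finset ℂ} (hZ : (Z : Set ℂ) ⊆ Ω) {α : ℂ → ℝ}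
    (hα : ∀ p ∈ Z, 0 < α p) {N : ℕ} {ξ : Fin N → ℂ} (hξ : memM Ω Z ξ) {K L T : ℝ} (hL : 0 ≤ L)
    (hK : ∀ j, H (ξ j) (ξ j) ≤ K) (hG : ∀ j k, j ≠ k → green H (ξ j) (ξ k) ≤ L) {i : Fin N}
    (hT : H (ξ i) (ξ i) ≤ T) :
    PsiFun H Z α ξ ≤ (1 / 2) * (N * K - K + T) + (1 / 2) * (N * (N * L)) := by
  have h1 : ∑ j, H (ξ j) (ξ j) ≤ N * K - K + T := by
    have hs : ∑ j ∈ Finset.univ.erase i, (H (ξ j) (ξ j) - K) ≤ 0 :=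
      Finset.sum_nonpos fun j _ => sub_nonpos.2 (hK j)
    have hadd := Finset.add_sum_erase Finset.univ (fun j => H (ξ j) (ξ j) - K) (Finset.mem_univ i)
    simp only [Finset.sum_sub_distrib (s := Finset.univ), Finset.sum_const, Finset.card_univ,
      Fintype.card_fin, nsmul_eq_mul] at hadd
    linarith
  have h2 : 0 ≤ ∑ p ∈ Z, (α p / 2) * ∑ j, green H (ξ j) p := by
    refine Finset.sum_nonneg fun p hp => mul_nonneg (half_pos (hα p hp)).le ?_
    refine Finset.sum_nonneg fun j _ => hH.green_nonneg hΩo hΩb (hξ.1 j).1 (hZ hp) ?_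
    rintro rfl
    exact (hξ.1 j).2 hp
  have h3 : ∑ j, ∑ k, (if j ≠ k then green H (ξ j) (ξ k) else 0) ≤ N * (N * L) := by
    have : ∀ j k : Fin N, (if j ≠ k then green H (ξ j) (ξ k) else 0) ≤ L := by
      intro j k
      split_ifs with h
      · exact hG j k h
      · exact hL
    calc ∑ j, ∑ k, (if j ≠ k then green H (ξ j) (ξ k) else 0)
        ≤ ∑ _j : Fin N, ∑ _k : Fin N, L :=
          Finset.sum_le_sum fun j _ => Finset.sum_le_sum fun k _ => this j k
      _ = N * (N * L) := by simp
  rw [PsiFun]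
  linarith

/-- A nonnegative sequence without a subsequence tending to zero is eventually bounded below by a
positive constant. -/
theorem exists_pos_eventually_le_of_no_subseq_tendsto_zero {r : ℕ → ℝ} (hr : ∀ n, 0 ≤ r n)
    (h : ¬∃ φ : ℕ → ℕ, StrictMono φ ∧ Tendsto (fun n => r (φ n)) atTop (nhds 0)) :
    ∃ c > 0, ∀ᶠ n in atTop, c ≤ r n := by
  by_contra! hcon
  have hfreq : ∀ m : ℕ, ∃ᶠ n in atTop, r n < 1 / ((m : ℝ) + 1) := fun m =>
    (hcon (1 / ((m : ℝ) + 1)) (by positivity)).mono fun n hn => hn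
  obtain ⟨φ, hφ, hlt⟩ := extraction_forall_of_frequently hfreq
  exact h ⟨φ, hφ, squeeze_zero (fun n => hr _) (fun n => (hlt n).le)
    tendsto_one_div_add_atTop_nhds_zero_nat⟩

/-- if (Ψ(ξ_n)) is bounded along a sequence in ℳ whose minimal mutual
distance tends to 0, then along a subsequence two components collide at a rate faster
than their distance to the boundary. -/
theorem collision_faster_than_boundary (Ω : Set ℂ) (hΩo : IsOpen Ω) (hΩc : IsConnected Ω)
    (hΩb : Bornology.IsBounded Ω) (b : C2Boundary Ω) (H : ℂ → ℂ → ℝ) (hH : RegPart Ω H)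
    (Z : Finset ℂ) (hZ : (Z : Set ℂ) ⊆ Ω) (α : ℂ → ℝ) (hα : ∀ p ∈ Z, 0 < α p)
    (N : ℕ) (hN : 1 ≤ N) (ξs : ℕ → Fin N → ℂ) (hmem : ∀ n, memM Ω Z (ξs n))
    (hΨ : ∃ C : ℝ, ∀ n, |PsiFun H Z α (ξs n)| ≤ C)
    (hsep : ∀ ε > (0 : ℝ), ∃ n₀ : ℕ, ∀ n ≥ n₀, ∃ j k : Fin N, j ≠ k ∧ ‖ξs n j - ξs n k‖ < ε) :
    ∃ j₀ k₀ : Fin N, j₀ ≠ k₀ ∧ ∃ φ : ℕ → ℕ, StrictMono φ ∧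
      Filter.Tendsto
        (fun n => ‖ξs (φ n) j₀ - ξs (φ n) k₀‖ / Metric.infDist (ξs (φ n) j₀) (frontier Ω))
        Filter.atTop (nhds 0) := by
  by_contra! hcon
  obtain ⟨C, hC⟩ := hΨ
  have hpair : ∀ q : Fin N × Fin N, ∃ c > 0, q.1 ≠ q.2 → ∀ᶠ n in atTop,
      c ≤ ‖ξs n q.1 - ξs n q.2‖ / Metric.infDist (ξs n q.1) (frontier Ω) := by
    rintro ⟨j, k⟩
    by_cases hjk : j = k
    · exact ⟨1, one_pos, fun h => absurd hjk h⟩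
    · obtain ⟨c, hc, hev⟩ := exists_pos_eventually_le_of_no_subseq_tendsto_zero
        (r := fun n => ‖ξs n j - ξs n k‖ / Metric.infDist (ξs n j) (frontier Ω))
        (fun n => div_nonneg (norm_nonneg _) Metric.infDist_nonneg)
        (fun ⟨φ, hφ, ht⟩ => hcon j k hjk φ hφ ht)
      exact ⟨c, hc, fun _ => hev⟩
  choose c₁ hc₁ hev₁ using hpair
  have : Nonempty (Fin N × Fin N) := ⟨(⟨0, hN⟩, ⟨0, hN⟩)⟩
  obtain ⟨q₀, hq₀⟩ := Finite.exists_min c₁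
  obtain ⟨c, hc, hcle⟩ : ∃ c > 0, ∀ q, c ≤ c₁ q := ⟨c₁ q₀, hc₁ q₀, hq₀⟩
  have hev : ∀ᶠ n in atTop, ∀ q : Fin N × Fin N, q.1 ≠ q.2 →
      0 < Metric.infDist (ξs n q.1) (frontier Ω) ∧
        c * Metric.infDist (ξs n q.1) (frontier Ω) ≤ ‖ξs n q.1 - ξs n q.2‖ := by
    rw [eventually_all]
    intro q
    by_cases hq : q.1 = q.2
    · exact Eventually.of_forall fun n h => absurd hq h
    · filter_upwards [hev₁ q hq] with n hn _
      have hle := (hcle q).trans hn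
      have hd : 0 < Metric.infDist (ξs n q.1) (frontier Ω) := by
        refine Metric.infDist_nonneg.lt_of_ne fun h0 => ?_
        rw [← h0, div_zero] at hle
        linarith
      exact ⟨hd, (le_div_iff₀ hd).1 hle⟩
  obtain ⟨δ, hδ, hnear⟩ := hH.exists_le_log_infDist hΩo hΩb b
  obtain ⟨K, hK⟩ := hH.exists_le hΩo hΩb
  obtain ⟨L₀, hL₀⟩ := hH.exists_green_le hΩo hΩb b hc
  set L := max L₀ 0 with hL
  set T : ℝ := -2 * C - 2 - N * K + K - N * (N * L) with hT
  obtain ⟨n₁, hn₁⟩ := eventually_atTop.1 hev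
  obtain ⟨n₂, hn₂⟩ := hsep (c * min δ (Real.exp (2 * π * T) / 6)) (by positivity)
  set n := max n₁ n₂
  obtain ⟨j, k, hjk, hlt⟩ := hn₂ n (le_max_right _ _)
  have hsepn := hn₁ n (le_max_left _ _)
  obtain ⟨hd0, hdle⟩ := hsepn (j, k) hjk
  have hdlt := lt_of_mul_lt_mul_left (hdle.trans_lt hlt) hc.le
  simp only at hd0 hdlt
  have hjΩ := ((hmem n).1 j).1
  have hHT : H (ξs n j) (ξs n j) ≤ T := by
    refine (hnear _ hjΩ (hdlt.trans_le (min_le_left _ _)) _ hjΩ).trans ?_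
    rw [sub_self, norm_zero, add_zero, one_div, inv_mul_le_iff₀ (by positivity),
      Real.log_le_iff_le_exp (by positivity)]
    have := hdlt.trans_le (min_le_right _ _)
    linarith
  have hup := hH.PsiFun_le hΩo hΩb hZ hα (hmem n) (le_max_right L₀ 0)
    (fun i => hK _ ((hmem n).1 i).1 _ ((hmem n).1 i).1)
    (fun i l hil => (hL₀ _ ((hmem n).1 i).1 _ ((hmem n).1 l).1
      (fun h => hil ((hmem n).2 h)) (hsepn (i, l) hil).2).trans (le_max_left L₀ 0)) hHT
  have hlow := (abs_le.1 (hC n)).1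
  rw [← hL] at hup
  linarith
end
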